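/- Let L > 0, k ≥ 1, let c ∈ Ω^k be a codebook, let m₀ > 0, and let P be a probability distribution on the space of Radon measures on Ω supported on measures that are supported in A_L and satisfy μ(V_j(c)) ≤ 2m₀ for all 1 ≤ j ≤ k. Let μ₁,…,μ_n be i.i.d. of law P and μ̄_n := (1/n)(μ₁+⋯+μ_n). Then for every x > 0, with probability at least 1 − e^{−x}, one has ‖w₂(c, μ̄_n) − w₂(c, E(P))‖ ≤ 2·m₀·L·√(2k/n)·(1 + √(x/2)), where ‖·‖ is the Euclidean norm on (ℝ²)^k. -/

import Mathlib

open MeasureTheory ENNReal Set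

noncomputable section

abbrev E2 := EuclideanSpace ℝ (Fin 2)

/-- The open half-plane `Ω` above the diagonal. -/
def Omega : Set E2 := {x | x 0 < x 1}

/-- The diagonal `∂Ω`. -/
def diagSet : Set E2 := {x | x 0 = x 1}

/-- `Ω̄ = Ω ∪ ∂Ω`. -/
def OmegaBar : Set E2 := Omega ∪ diagSet

/-- Euclidean distance of a point to the diagonal. -/
def dDiag (x : E2) : ℝ := Metric.infDist x diagSet

/-- Total persistence `Pers_p(μ) = ∫_Ω ‖x-∂Ω‖^p dμ(x)`. -/
def Pers (p : ℝ) (μ : Measure E2) : ℝ≥0∞ :=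
  ∫⁻ x in Omega, ENNReal.ofReal (dDiag x ^ p) ∂μ

/-- Admissible partial transport plans: measures on `Ω̄ × Ω̄` whose first (resp. second)
marginal coincides with `μ` (resp. `ν`) on `Ω`. -/
def Adm (μ ν : Measure E2) : Set (Measure (E2 × E2)) :=
  {π | (π.map Prod.fst).restrict Omega = μ.restrict Omega ∧
       (π.map Prod.snd).restrict Omega = ν.restrict Omega ∧
       π ((OmegaBar ×ˢ OmegaBar)ᶜ) = 0}

/-- `OT_p(μ,ν)^p`, the optimal partial transport cost. -/
def OTpow (p : ℝ) (μ ν : Measure E2) : ℝ≥0∞ :=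
  ⨅ π ∈ Adm μ ν, ∫⁻ z, ENNReal.ofReal (dist z.1 z.2 ^ p) ∂π

/-- The distance `OT_p(μ,ν)`. -/
def OTp (p : ℝ) (μ ν : Measure E2) : ℝ≥0∞ := (OTpow p μ ν) ^ (1/p)

/-- The closed ℓ¹-ball `A_L` of radius `L/√2` centered at `(-L/√8, L/√8)`. -/
def ballA (L : ℝ) : Set E2 :=
  {x | |x 0 + L / Real.sqrt 8| + |x 1 - L / Real.sqrt 8| ≤ L / Real.sqrt 2}

/-- Membership in `M^q_{L,M}`: supported in `Ω`, in `A_L`, with `Pers_q ≤ M`. -/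
def MemMq (q L M : ℝ) (μ : Measure E2) : Prop :=
  μ Omegaᶜ = 0 ∧ μ (ballA L)ᶜ = 0 ∧ Pers q μ ≤ ENNReal.ofReal M

/-- Empirical EPD `μ̄_n = (1/n)(μ₁ + ⋯ + μ_n)` of a sample of `n` persistence measures. -/
def empEPD (n : ℕ) (ω : Fin n → Measure E2) : Measure E2 :=
  (n : ℝ≥0∞)⁻¹ • ∑ i : Fin n, ω i

/-- Distance from `x` to the `j`-th centroid, the last index standing for the diagonal. -/
def cdistC (k : ℕ) (c : Fin k → E2) (j : Fin (k+1)) (x : E2) : ℝ :=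
  if h : (j : ℕ) < k then dist x (c ⟨j, h⟩) else dDiag x

/-- Voronoi cells `V_j(c)` (the last cell being the diagonal cell `V_{k+1}`). -/
def Vcell (k : ℕ) (c : Fin k → E2) (j : Fin (k+1)) : Set E2 :=
  {x ∈ Omega | (∀ j' : Fin (k+1), j' < j → cdistC k c j x ≤ cdistC k c j' x) ∧
               (∀ j' : Fin (k+1), j < j' → cdistC k c j x < cdistC k c j' x)}

/-- The distortion `R_{k,p}(c)`. -/
def distortion (p : ℝ) (μ : Measure E2) (k : ℕ) (c : Fin k → E2) : ℝ≥0∞ :=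
  (∑ j : Fin (k+1), ∫⁻ x in Vcell k c j, ENNReal.ofReal (cdistC k c j x ^ p) ∂μ) ^ (1/p)

/-- The optimal distortion `R_k^* = inf {R_{k,p}(c) : c ∈ Ω̄^k}`. -/
def Rstar (p : ℝ) (μ : Measure E2) (k : ℕ) : ℝ≥0∞ :=
  ⨅ (c : Fin k → E2) (_ : ∀ j, c j ∈ OmegaBar), distortion p μ k c

/-- The set `C_k` of optimal codebooks. -/
def Copt (p : ℝ) (μ : Measure E2) (k : ℕ) : Set (Fin k → E2) :=
  {c | (∀ j, c j ∈ OmegaBar) ∧ distortion p μ k c = Rstar p μ k}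

/-- Support of a measure. -/
def msupport (μ : Measure E2) : Set E2 :=
  {x | ∀ U : Set E2, IsOpen U → x ∈ U → 0 < μ U}

/-- Euclidean distance between codebooks seen as vectors of `ℝ^{2k}`. -/
def cbDist (k : ℕ) (c c' : Fin k → E2) : ℝ :=
  Real.sqrt (∑ j : Fin k, dist (c j) (c' j) ^ 2)

/-- Euclidean norm on `(ℝ²)^k`. -/
def pnorm2 (k : ℕ) (v : Fin k → E2) : ℝ := Real.sqrt (∑ j : Fin k, ‖v j‖ ^ 2)

/-- Distance between the `j`-th and `j'`-th centroids, the last index standing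
for the diagonal. -/
def cdistPt (k : ℕ) (c : Fin k → E2) (j j' : Fin (k+1)) : ℝ :=
  if h : (j : ℕ) < k then
    (if h' : (j' : ℕ) < k then dist (c ⟨j, h⟩) (c ⟨j', h'⟩) else dDiag (c ⟨j, h⟩))
  else (if h' : (j' : ℕ) < k then dDiag (c ⟨j', h'⟩) else 0)

/-- The set `N(c)` of points lying on a boundary between two Voronoi cells. -/
def Nset (k : ℕ) (c : Fin k → E2) : Set E2 :=
  {x ∈ Omega | ∃ j j' : Fin (k+1), j < j' ∧ x ∈ Vcell k c j ∧ cdistC k c j x = cdistC k c j' x}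

/-- The `t`-neighborhood `A^t` of `A` in `Ω`. -/
def tN (A : Set E2) (t : ℝ) : Set E2 := {x ∈ Omega | ∃ a ∈ A, dist x a ≤ t}

/-- `w₂(c, m)_j = ∫_{V_j(c)} x dm(x)`. -/
def w2 (k : ℕ) (c : Fin k → E2) (m : Measure E2) (j : Fin k) : E2 :=
  ∫ x in Vcell k c j.castSucc, x ∂m

/-- Absolute difference in `ℝ≥0∞`. -/
def eabs (a b : ℝ≥0∞) : ℝ≥0∞ := (a - b) + (b - a)

open scoped NNReal
open ProbabilityTheory
lemma integral_pi_succ {α : Type*} [MeasurableSpace α] (P : Measure α) [SigmaFinite P]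
    (n : ℕ) (f : (Fin (n + 1) → α) → ℝ) :
    ∫ ω, f ω ∂(Measure.pi fun _ => P) =
      ∫ z : α × (Fin n → α), f (Fin.cons z.1 z.2) ∂(P.prod (Measure.pi fun _ => P)) := by
  rw [← (measurePreserving_piFinSuccAbove (fun _ : Fin (n + 1) => P) 0).symm.integral_comp']
  simp [MeasurableEquiv.piFinSuccAbove_symm_apply, Fin.insertNthEquiv, Fin.insertNth_zero']

lemma measurable_finCons {α : Type*} [MeasurableSpace α] (n : ℕ) :
    Measurable fun z : α × (Fin n → α) => (Fin.cons z.1 z.2 : Fin (n + 1) → α) := by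
  refine measurable_pi_iff.2 fun i => ?_
  refine Fin.cases ?_ (fun j => ?_) i
  · simpa using measurable_fst
  · simp only [Fin.cons_succ]
    fun_prop

lemma integrable_of_abs_le {α : Type*} [MeasurableSpace α] {P : Measure α} [IsFiniteMeasure P]
    {f : α → ℝ} (hf : Measurable f) {B : ℝ} (hB : ∀ a, |f a| ≤ B) : Integrable f P :=
  Integrable.of_bound hf.aestronglyMeasurable B (Filter.Eventually.of_forall hB)

lemma abs_integral_le_of_abs_le {α : Type*} [MeasurableSpace α] {P : Measure α}
    [IsProbabilityMeasure P] {f : α → ℝ} {B : ℝ} (hB : ∀ a, |f a| ≤ B) :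
    |∫ a, f a ∂P| ≤ B := by
  simpa using norm_integral_le_of_norm_le_const (μ := P) (f := f) (Filter.Eventually.of_forall hB)

lemma abs_exp_mul_sub_le {B s u v : ℝ} (hu : |u| ≤ B) (hv : |v| ≤ B) :
    |Real.exp (s * (u - v))| ≤ Real.exp (|s| * (2 * B)) := by
  rw [abs_of_pos (Real.exp_pos _), Real.exp_le_exp]
  calc s * (u - v) ≤ |s * (u - v)| := le_abs_self _
    _ = |s| * |u - v| := abs_mul _ _
    _ ≤ |s| * (2 * B) := by
        gcongr
        linarith [abs_sub u v]

/-- Bounded differences (McDiarmid): exponential moments of a function of i.i.d. variables. -/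
lemma integral_exp_le_of_bounded_differences {α : Type*} [MeasurableSpace α] (P : Measure α)
    [IsProbabilityMeasure P] (D : ℝ≥0) (s B : ℝ) (n : ℕ) (f : (Fin n → α) → ℝ)
    (hf : Measurable f) (hB : ∀ ω, |f ω| ≤ B)
    (hD : ∀ ω i a, f (Function.update ω i a) ≤ f ω + D) :
    ∫ ω, Real.exp (s * (f ω - ∫ ω', f ω' ∂(Measure.pi fun _ => P))) ∂(Measure.pi fun _ => P) ≤
      Real.exp (n * ((D / 2) ^ 2 : ℝ≥0) * s ^ 2 / 2) := by
  induction n with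
  | zero =>
    simp only [Measure.pi_of_empty (fun _ : Fin 0 => P) (fun i => i.elim0)]
    simp
  | succ n ih =>
    have : Nonempty α := nonempty_of_isProbabilityMeasure P
    set Q : Measure (Fin n → α) := Measure.pi fun _ => P with hQ
    set g : α × (Fin n → α) → ℝ := fun z => f (Fin.cons z.1 z.2) with hg
    have hgm : Measurable g := hf.comp (measurable_finCons n)
    have hgB : ∀ z, |g z| ≤ B := fun z => hB _
    set F : (Fin n → α) → ℝ := fun r => ∫ a, g (a, r) ∂P with hF
    have hFm : Measurable F := (hgm.stronglyMeasurable.integral_prod_left').measurable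
    have hFB : ∀ r, |F r| ≤ B := fun r => abs_integral_le_of_abs_le fun a => hgB _
    have hga : ∀ r, Integrable (fun a => g (a, r)) P := fun r =>
      integrable_of_abs_le (hgm.comp measurable_prodMk_right) fun a => hgB _
    have hgi : Integrable g (P.prod Q) := integrable_of_abs_le hgm hgB
    have hFD : ∀ r i a, F (Function.update r i a) ≤ F r + D := by
      intro r i b
      have : F r + D = ∫ a, (g (a, r) + D) ∂P := by
        rw [integral_add (hga r) (integrable_const _)]; simp [hF]
      rw [this]
      refine integral_mono (hga _) ((hga r).add (integrable_const _)) fun a => ?_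
      have := hD (Fin.cons a r) i.succ b
      rwa [← Fin.cons_update] at this
    set M := ∫ r, F r ∂Q with hM
    have hMf : ∫ ω, f ω ∂(Measure.pi fun _ => P) = M := by
      rw [integral_pi_succ, integral_prod_symm _ hgi]
    have hMB : |M| ≤ B := abs_integral_le_of_abs_le hFB
    have hinner : ∀ r, ∫ a, Real.exp (s * (g (a, r) - F r)) ∂P ≤
        Real.exp (((D / 2) ^ 2 : ℝ≥0) * s ^ 2 / 2) := by
      intro r
      have hbdd : BddBelow (range fun a => g (a, r)) :=
        ⟨-B, by rintro _ ⟨a, rfl⟩; exact (abs_le.1 (hgB _)).1⟩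
      have hIcc : ∀ a, g (a, r) ∈ Icc (⨅ a', g (a', r)) ((⨅ a', g (a', r)) + D) := by
        intro a
        refine ⟨ciInf_le hbdd a, ?_⟩
        rw [← sub_le_iff_le_add]
        refine le_ciInf fun a' => ?_
        have := hD (Fin.cons a' r) 0 a
        rw [Fin.update_cons_zero] at this
        linarith
      have h := (hasSubgaussianMGF_of_mem_Icc (μ := P) (X := fun a => g (a, r))
        (hgm.comp measurable_prodMk_right).aemeasurable
        (Filter.Eventually.of_forall hIcc)).mgf_le s
      simpa [mgf] using h
    rw [hMf, integral_pi_succ]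
    have hei : Integrable (fun z : α × (Fin n → α) => Real.exp (s * (g z - M))) (P.prod Q) :=
      integrable_of_abs_le (by fun_prop) fun z => abs_exp_mul_sub_le (hgB z) hMB
    have hFi : Integrable (fun r => Real.exp (s * (F r - M))) Q :=
      integrable_of_abs_le (by fun_prop) fun z => abs_exp_mul_sub_le (hFB z) hMB
    rw [integral_prod_symm _ hei]
    calc ∫ r, ∫ a, Real.exp (s * (g (a, r) - M)) ∂P ∂Q
        ≤ ∫ r, Real.exp (((D / 2) ^ 2 : ℝ≥0) * s ^ 2 / 2) * Real.exp (s * (F r - M)) ∂Q := by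
          refine integral_mono hei.integral_prod_right (hFi.const_mul _) fun r => ?_
          have : ∀ a, Real.exp (s * (g (a, r) - M)) =
              Real.exp (s * (g (a, r) - F r)) * Real.exp (s * (F r - M)) := fun a => by
            rw [← Real.exp_add]; ring_nf
          simp only [this, integral_mul_const]
          gcongr
          exact hinner r
      _ ≤ Real.exp (((D / 2) ^ 2 : ℝ≥0) * s ^ 2 / 2) *
            Real.exp (n * ((D / 2) ^ 2 : ℝ≥0) * s ^ 2 / 2) := by
          rw [integral_const_mul]
          gcongr
          exact ih F hFm hFB hFD
      _ = _ := by
          rw [← Real.exp_add]; push_cast; ring_nf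

lemma hasSubgaussianMGF_of_bounded_differences {α : Type*} [MeasurableSpace α] (P : Measure α)
    [IsProbabilityMeasure P] (D : ℝ≥0) (B : ℝ) (n : ℕ) (f : (Fin n → α) → ℝ)
    (hf : Measurable f) (hB : ∀ ω, |f ω| ≤ B)
    (hD : ∀ ω i a, f (Function.update ω i a) ≤ f ω + D) :
    HasSubgaussianMGF (fun ω => f ω - ∫ ω', f ω' ∂(Measure.pi fun _ => P)) (n * (D / 2) ^ 2)
      (Measure.pi fun _ => P) where
  integrable_exp_mul t := integrable_of_abs_le (by fun_prop) fun ω =>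
    abs_exp_mul_sub_le (hB ω) (abs_integral_le_of_abs_le hB)
  mgf_le t := by
    simpa [mgf] using integral_exp_le_of_bounded_differences P D t B n f hf hB hD

lemma norm_add_sum_le {α H : Type*} [SeminormedAddCommGroup H] {Z : α → H} {D : ℝ} (hZ : ∀ a, ‖Z a‖ ≤ D) {n : ℕ} (v : H)
    (ω : Fin n → α) : ‖v + ∑ i, Z (ω i)‖ ≤ ‖v‖ + n * D := by
  refine (norm_add_le _ _).trans ?_
  gcongr
  refine (norm_sum_le _ _).trans ((Finset.sum_le_sum fun i _ => hZ (ω i)).trans ?_)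
  simp

section Hilbert

variable {α H : Type*} [MeasurableSpace α] [NormedAddCommGroup H] [InnerProductSpace ℝ H]
  [CompleteSpace H] [SecondCountableTopology H] [MeasurableSpace H] [BorelSpace H]

/-- Second moment of a sum of i.i.d. centered bounded vectors. -/
lemma integral_norm_sq_sum_le (P : Measure α) [IsProbabilityMeasure P] {Z : α → H}
    (hZm : Measurable Z) (hZ0 : ∫ a, Z a ∂P = 0) {D : ℝ} (hZ : ∀ a, ‖Z a‖ ≤ D) (n : ℕ) (v : H) :
    ∫ ω : Fin n → α, ‖v + ∑ i, Z (ω i)‖ ^ 2 ∂(Measure.pi fun _ => P) ≤ ‖v‖ ^ 2 + n * D ^ 2 := by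
  induction n generalizing v with
  | zero => simp
  | succ n ih =>
    have hZi : Integrable Z P :=
      Integrable.of_bound hZm.aestronglyMeasurable D (Filter.Eventually.of_forall hZ)
    have hD : 0 ≤ D := by
      obtain ⟨a⟩ : Nonempty α := nonempty_of_isProbabilityMeasure P
      exact (norm_nonneg _).trans (hZ a)
    have hi : Integrable (fun z : α × (Fin n → α) => ‖v + Z z.1 + ∑ i, Z (z.2 i)‖ ^ 2)
        (P.prod (Measure.pi fun _ => P)) := by
      refine integrable_of_abs_le (B := ((‖v‖ + D) + n * D) ^ 2) (by fun_prop) fun z => ?_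
      rw [abs_of_nonneg (by positivity)]
      have h1 := norm_add_sum_le hZ (v + Z z.1) z.2
      have h2 := (norm_add_le v (Z z.1)).trans (add_le_add_right (hZ z.1) ‖v‖)
      gcongr
      linarith
    have hi2 : Integrable (fun a => ‖Z a‖ ^ 2) P :=
      integrable_of_abs_le (B := D ^ 2) (by fun_prop) fun a => by
        rw [abs_of_nonneg (by positivity)]
        gcongr
        exact hZ a
    have hi3 : Integrable (fun a => inner ℝ v (Z a)) P := hZi.const_inner v
    rw [integral_pi_succ]
    simp only [Fin.sum_univ_succ, Fin.cons_zero, Fin.cons_succ, ← add_assoc]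
    rw [integral_prod _ hi]
    calc ∫ a, ∫ r : Fin n → α, ‖v + Z a + ∑ i, Z (r i)‖ ^ 2 ∂(Measure.pi fun _ => P) ∂P
        ≤ ∫ a, ((‖v‖ ^ 2 + n * D ^ 2) + 2 * inner ℝ v (Z a) + ‖Z a‖ ^ 2) ∂P := by
          refine integral_mono hi.integral_prod_left
            (((integrable_const _).add (hi3.const_mul 2)).add hi2) fun a => ?_
          refine (ih (v + Z a)).trans ?_
          rw [norm_add_sq_real]
          linarith
      _ = (‖v‖ ^ 2 + n * D ^ 2) + ∫ a, ‖Z a‖ ^ 2 ∂P := by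
          have h1 := integral_add ((integrable_const (‖v‖ ^ 2 + n * D ^ 2)).add
            (hi3.const_mul 2)) hi2
          simp only [Pi.add_apply] at h1
          rw [h1, integral_add (integrable_const _) (hi3.const_mul 2), integral_const_mul,
            integral_inner hZi, hZ0]
          simp
      _ ≤ (‖v‖ ^ 2 + n * D ^ 2) + D ^ 2 := by
          gcongr
          have := abs_integral_le_of_abs_le (P := P) (f := fun a => ‖Z a‖ ^ 2) (B := D ^ 2)
            fun a => by
              rw [abs_of_nonneg (by positivity)]
              gcongr
              exact hZ a
          exact (le_abs_self _).trans this
      _ = _ := by push_cast; ring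

/-- Concentration of the norm of a sum of i.i.d. centered vectors with values in a set of
diameter at most `D`. -/
lemma measure_norm_sum_ge_le (P : Measure α) [IsProbabilityMeasure P] {Z : α → H}
    (hZm : Measurable Z) (hZ0 : ∫ a, Z a ∂P = 0) {D : ℝ≥0} (hDpos : 0 < D)
    (hZ : ∀ a, ‖Z a‖ ≤ D) (hZZ : ∀ a b, ‖Z a - Z b‖ ≤ D) {n : ℕ} (hn : 1 ≤ n)
    {x : ℝ} (hx : 0 < x) :
    (Measure.pi fun _ : Fin n => P).real
      {ω | D * √n * (1 + √(x / 2)) ≤ ‖∑ i, Z (ω i)‖} ≤ Real.exp (-x) := by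
  set Q : Measure (Fin n → α) := Measure.pi fun _ => P with hQ
  set f : (Fin n → α) → ℝ := fun ω => ‖∑ i, Z (ω i)‖ with hf
  have hfm : Measurable f := by fun_prop
  have hfB : ∀ ω, |f ω| ≤ n * D := fun ω => by
    simpa [f] using norm_add_sum_le hZ 0 ω
  have hfD : ∀ ω i a, f (Function.update ω i a) ≤ f ω + D := by
    intro ω i a
    have : ∑ j, Z (Function.update ω i a j) = ∑ j, Z (ω j) + (Z a - Z (ω i)) := by
      rw [← Finset.add_sum_erase _ _ (Finset.mem_univ i),
        ← Finset.add_sum_erase _ (fun j => Z (ω j)) (Finset.mem_univ i),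
        Finset.sum_congr rfl fun j hj => by
          rw [Function.update_of_ne (Finset.ne_of_mem_erase hj)]]
      simp only [Function.update_self]
      abel
    simp only [hf, this]
    exact (norm_add_le _ _).trans (by gcongr; exact hZZ _ _)
  have hmean : ∫ ω, f ω ∂Q ≤ D * √n := by
    have h2 := integral_norm_sq_sum_le P hZm hZ0 hZ n 0
    simp only [zero_add, norm_zero, ne_eq, OfNat.ofNat_ne_zero, not_false_eq_true, zero_pow] at h2
    have hfi : MemLp f 2 Q := MemLp.of_bound hfm.aestronglyMeasurable (n * D)
      (Filter.Eventually.of_forall hfB)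
    have hvar := variance_nonneg f Q
    rw [variance_eq_sub hfi] at hvar
    have h3 : (∫ ω, f ω ∂Q) ^ 2 ≤ (D * √n) ^ 2 := by
      rw [mul_pow, Real.sq_sqrt (by positivity)]
      have : ∫ ω, (f ^ 2) ω ∂Q ≤ n * D ^ 2 := h2
      linarith
    exact le_of_sq_le_sq h3 (by positivity)
  have hsub := hasSubgaussianMGF_of_bounded_differences P D (n * D) n f hfm hfB hfD
  have hn' : (0 : ℝ) < n := by exact_mod_cast hn
  have hD' : (0 : ℝ) < D := hDpos
  have hε : 0 ≤ D * √n * √(x / 2) := by positivity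
  have key := hsub.measure_ge_le hε
  have hexp : -(D * √n * √(x / 2)) ^ 2 / (2 * ((n * (D / 2) ^ 2 : ℝ≥0) : ℝ)) = -x := by
    rw [mul_pow, mul_pow, Real.sq_sqrt hn'.le, Real.sq_sqrt (by positivity)]
    push_cast
    field_simp
  rw [hexp] at key
  refine le_trans (measureReal_mono fun ω hω => ?_) key
  simp only [mem_ofPred_eq] at hω ⊢
  change _ ≤ f ω at hω
  linarith

/-- Concentration of empirical means of i.i.d. vectors with values in a ball of radius `R`. -/
lemma measure_norm_mean_sub_ge_le (P : Measure α) [IsProbabilityMeasure P] {Y : α → H}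
    (hY : Measurable Y) (b : H) {R : ℝ} (hR : 0 < R) (hYb : ∀ a, ‖Y a - b‖ ≤ R)
    {n : ℕ} (hn : 1 ≤ n) {x : ℝ} (hx : 0 < x) :
    (Measure.pi fun _ : Fin n => P).real
      {ω | 2 * R / √n * (1 + √(x / 2)) < ‖(n : ℝ)⁻¹ • ∑ i, Y (ω i) - ∫ a, Y a ∂P‖} ≤
      Real.exp (-x) := by
  have hYi : Integrable Y P := by
    refine Integrable.of_bound hY.aestronglyMeasurable (R + ‖b‖)
      (Filter.Eventually.of_forall fun a => ?_)
    calc ‖Y a‖ = ‖(Y a - b) + b‖ := by rw [sub_add_cancel]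
      _ ≤ _ := (norm_add_le _ _).trans (by gcongr; exact hYb a)
  have hYY : ∀ a a', ‖Y a - Y a'‖ ≤ 2 * R := fun a a' => by
    calc ‖Y a - Y a'‖ = ‖(Y a - b) - (Y a' - b)‖ := by rw [sub_sub_sub_cancel_right]
      _ ≤ _ := (norm_sub_le _ _).trans (by linarith [hYb a, hYb a'])
  set m := ∫ a, Y a ∂P with hm
  have hZ : ∀ a, ‖Y a - m‖ ≤ 2 * R := fun a => by
    have : Y a - m = ∫ a', (Y a - Y a') ∂P := by
      rw [integral_sub (integrable_const _) hYi]; simp [hm]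
    rw [this]
    simpa using norm_integral_le_of_norm_le_const (μ := P)
      (Filter.Eventually.of_forall fun a' => hYY a a')
  have hn' : (0 : ℝ) < n := by exact_mod_cast hn
  lift R to ℝ≥0 using hR.le
  have key := measure_norm_sum_ge_le P (Z := fun a => Y a - m) (D := 2 * R)
    (by fun_prop) (by rw [integral_sub hYi (integrable_const _)]; simp [hm])
    (mul_pos two_pos (by exact_mod_cast hR)) (by simpa using hZ)
    (fun a a' => by simpa using hYY a a') hn hx
  refine le_trans (measureReal_mono fun ω hω => ?_) key
  simp only [mem_ofPred_eq, NNReal.coe_mul, NNReal.coe_ofNat] at hω ⊢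
  have h1 : ∑ i, (Y (ω i) - m) = (n : ℝ) • ((n : ℝ)⁻¹ • ∑ i, Y (ω i) - m) := by
    rw [smul_sub, smul_inv_smul₀ hn'.ne', Finset.sum_sub_distrib]
    simp [Nat.cast_smul_eq_nsmul]
  rw [h1, norm_smul, Real.norm_of_nonneg hn'.le]
  have h2 : 2 * R * √n = n * (2 * R / √n) := by
    have : (√n) ^ 2 = (n : ℝ) := Real.sq_sqrt hn'.le
    field_simp
    rw [this]
  rw [h2, mul_assoc]
  gcongr

end Hilbert

section TruncatedKernel

variable {E : Type*} [MeasurableSpace E]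

lemma measurable_restrict_measure {V : Set E} (hV : MeasurableSet V) :
    Measurable fun μ : Measure E => μ.restrict V :=
  Measure.measurable_of_measurable_coe _ fun s hs => by
    simp only [Measure.restrict_apply hs]
    exact Measure.measurable_coe (hs.inter hV)

open Classical in
/-- Restriction of a measure to `V ∩ A`, replaced by zero where `V` has mass more than `M`. -/
def truncRestrict (V A : Set E) (hV : MeasurableSet V) (hA : MeasurableSet A) (M : ℝ≥0∞) :
    Kernel (Measure E) E where
  toFun μ := if μ V ≤ M then μ.restrict (V ∩ A) else 0
  measurable' := Measurable.ite
    (measurableSet_le (Measure.measurable_coe hV) measurable_const)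
    (measurable_restrict_measure (hV.inter hA)) measurable_const

variable {V A : Set E} (hV : MeasurableSet V) (hA : MeasurableSet A) {M : ℝ≥0∞}

lemma truncRestrict_univ_le (μ : Measure E) : truncRestrict V A hV hA M μ univ ≤ M := by
  change (if μ V ≤ M then μ.restrict (V ∩ A) else 0 : Measure E) univ ≤ M
  split_ifs with h
  · simpa using (measure_mono inter_subset_left).trans h
  · simp

lemma truncRestrict_compl (μ : Measure E) : truncRestrict V A hV hA M μ Aᶜ = 0 := by
  change (if μ V ≤ M then μ.restrict (V ∩ A) else 0 : Measure E) Aᶜ = 0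
  split_ifs with h
  · rw [Measure.restrict_apply hA.compl]
    simp [show Aᶜ ∩ (V ∩ A) = ∅ by ext; simp; tauto]
  · simp

lemma truncRestrict_eq {μ : Measure E} (h : μ V ≤ M) (hμA : μ Aᶜ = 0) :
    truncRestrict V A hV hA M μ = μ.restrict V := by
  change (if μ V ≤ M then μ.restrict (V ∩ A) else 0 : Measure E) = _
  rw [if_pos h]
  refine Measure.restrict_congr_set ?_
  have : ∀ᵐ x ∂μ, x ∈ A := hμA
  filter_upwards [this] with x hx
  exact propext ⟨fun h => h.1, fun h => ⟨h, hx⟩⟩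

lemma isFiniteKernel_truncRestrict (hM : M < ∞) :
    IsFiniteKernel (truncRestrict V A hV hA M) :=
  ⟨⟨M, hM, truncRestrict_univ_le hV hA⟩⟩

lemma join_restrict_eq_comp_truncRestrict {P : Measure (Measure E)}
    (hP : ∀ᵐ μ ∂P, μ V ≤ M ∧ μ Aᶜ = 0) :
    P.join.restrict V = P.bind (truncRestrict V A hV hA M) := by
  ext s hs
  rw [Measure.restrict_apply hs, Measure.join_apply (hs.inter hV),
    Measure.bind_apply hs (Kernel.aemeasurable _)]
  refine lintegral_congr_ae ?_
  filter_upwards [hP] with μ hμ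
  rw [truncRestrict_eq hV hA hμ.1 hμ.2, Measure.restrict_apply hs]

end TruncatedKernel

/-- If `ν` has mass at most `M` and is carried by the ball of center `a` and radius `r ≥ ‖a‖`,
its first moment lies in the ball of center `M • a` and radius `M * r`. -/
lemma norm_integral_sub_smul_le {E : Type*} [NormedAddCommGroup E] [NormedSpace ℝ E]
    [CompleteSpace E] [MeasurableSpace E] [BorelSpace E] [SecondCountableTopology E]
    {ν : Measure E} {M : ℝ} (hM : 0 ≤ M)
    (hν : ν univ ≤ ENNReal.ofReal M) {a : E} {r : ℝ} (har : ‖a‖ ≤ r)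
    (hνa : ∀ᵐ x ∂ν, ‖x - a‖ ≤ r) : ‖∫ x, x ∂ν - M • a‖ ≤ M * r := by
  have : IsFiniteMeasure ν := ⟨hν.trans_lt ENNReal.ofReal_lt_top⟩
  have hmass : ν.real univ ≤ M := ENNReal.toReal_le_of_le_ofReal hM hν
  have hi : Integrable (fun x => x - a) ν :=
    Integrable.of_bound (by fun_prop) r hνa
  have hx : Integrable (fun x : E => x) ν := by
    refine (hi.add (integrable_const a)).congr (Filter.Eventually.of_forall fun x => ?_)
    simp
  have h1 : ∫ x, x ∂ν - M • a = ∫ x, (x - a) ∂ν - (M - ν.real univ) • a := by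
    rw [integral_sub hx (integrable_const a), integral_const]
    module
  have h2 := norm_integral_le_of_norm_le_const hνa
  rw [h1]
  calc _ ≤ _ := norm_sub_le _ _
    _ ≤ r * ν.real univ + (M - ν.real univ) * r := by
        rw [norm_smul, Real.norm_of_nonneg (by linarith)]
        gcongr
    _ = M * r := by ring

lemma continuous_cdistC (k : ℕ) (c : Fin k → E2) (j : Fin (k + 1)) :
    Continuous (cdistC k c j) := by
  unfold cdistC
  split_ifs
  · fun_prop
  · exact Metric.continuous_infDist_pt _

lemma measurableSet_Vcell (k : ℕ) (c : Fin k → E2) (j : Fin (k + 1)) :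
    MeasurableSet (Vcell k c j) := by
  have h := fun i => (continuous_cdistC k c i).measurable
  have hΩ : MeasurableSet Omega := measurableSet_lt (by fun_prop) (by fun_prop)
  refine hΩ.inter (MeasurableSet.inter ?_ ?_)
  · exact measurableSet_setOfPred.2 <| Measurable.forall fun i => Measurable.imp measurable_const
      (measurableSet_setOfPred.1 (measurableSet_le (h j) (h i)))
  · exact measurableSet_setOfPred.2 <| Measurable.forall fun i => Measurable.imp measurable_const
      (measurableSet_setOfPred.1 (measurableSet_lt (h j) (h i)))

lemma measurableSet_ballA (L : ℝ) : MeasurableSet (ballA L) :=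
  measurableSet_le (by fun_prop) (by fun_prop)

/-- Center of the square `ballA L`. -/
def centerA (L : ℝ) : E2 := !₂[-(L / √8), L / √8]

lemma norm_sub_centerA_le {L : ℝ} {x : E2} (hx : x ∈ ballA L) : ‖x - centerA L‖ ≤ L / √2 := by
  refine le_trans ?_ (show _ ≤ L / √2 from hx)
  rw [EuclideanSpace.norm_eq]
  refine Real.sqrt_le_iff.2 ⟨by positivity, ?_⟩
  simp only [Fin.sum_univ_two, centerA, PiLp.sub_apply, Real.norm_eq_abs]
  simp only [Matrix.cons_val_zero, Matrix.cons_val_one, sub_neg_eq_add]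
  nlinarith [abs_nonneg (x 0 + L / √8), abs_nonneg (x 1 - L / √8),
    mul_nonneg (abs_nonneg (x 0 + L / √8)) (abs_nonneg (x 1 - L / √8))]

lemma norm_centerA_le {L : ℝ} (hL : 0 < L) : ‖centerA L‖ ≤ L / √2 := by
  have h8 : (0 : ℝ) < √8 := by positivity
  rw [EuclideanSpace.norm_eq]
  refine Real.sqrt_le_iff.2 ⟨by positivity, ?_⟩
  simp only [Fin.sum_univ_two, centerA, Real.norm_eq_abs, sq_abs]
  simp only [Matrix.cons_val_zero, Matrix.cons_val_one, neg_sq, div_pow]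
  rw [Real.sq_sqrt (by norm_num), Real.sq_sqrt (by norm_num)]
  nlinarith [sq_nonneg L]

lemma w2_empEPD {k n : ℕ} (c : Fin k → E2) (ω : Fin n → Measure E2) (j : Fin k)
    (h : ∀ i, IntegrableOn (fun x : E2 => x) (Vcell k c j.castSucc) (ω i)) :
    w2 k c (empEPD n ω) j = (n : ℝ)⁻¹ • ∑ i, w2 k c (ω i) j := by
  have hV := measurableSet_Vcell k c j.castSucc
  unfold w2 empEPD
  rw [Measure.restrict_smul, integral_smul_measure]
  have hs : (∑ i, ω i).restrict (Vcell k c j.castSucc) =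
      ∑ i, (ω i).restrict (Vcell k c j.castSucc) := by
    ext s hs
    simp [Measure.restrict_apply hs]
  rw [hs, integral_finsetSum_measure fun i _ => h i]
  simp

/-- Lemma: concentration of the empirical cell means `w₂`.
If `P` is supported on measures supported in `A_L` with `μ(V_j(c)) ≤ 2m₀` for all `j`, then
for every `x > 0`, with probability at least `1 - e^{-x}`,
`‖w₂(c, μ̄_n) - w₂(c, E(P))‖ ≤ 2 m₀ L √(2k/n) (1 + √(x/2))`. -/
theorem statement13 (L : ℝ) (hL : 0 < L) (k : ℕ) (hk : 1 ≤ k)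
    (c : Fin k → E2) (hc : ∀ j, c j ∈ Omega)
    (m0 : ℝ) (hm0 : 0 < m0)
    (P : Measure (Measure E2)) [IsProbabilityMeasure P]
    (hP : ∀ᵐ μ ∂P, μ Omegaᶜ = 0 ∧ μ (ballA L)ᶜ = 0 ∧
      ∀ j : Fin k, μ (Vcell k c j.castSucc) ≤ ENNReal.ofReal (2 * m0))
    (n : ℕ) (hn : 1 ≤ n) (x : ℝ) (hx : 0 < x) :
    ENNReal.ofReal (1 - Real.exp (-x)) ≤
      (Measure.pi fun _ : Fin n => P) {ω |
        pnorm2 k (fun j => w2 k c (empEPD n ω) j - w2 k c P.join j) ≤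
          2 * m0 * L * Real.sqrt (2 * k / n) * (1 + Real.sqrt (x / 2))} := by
  have hV := fun j : Fin k => measurableSet_Vcell k c j.castSucc
  have hA := measurableSet_ballA L
  set M := ENNReal.ofReal (2 * m0) with hM
  let κ : Fin k → Kernel (Measure E2) E2 := fun j => truncRestrict _ _ (hV j) hA M
  have hκfin : ∀ j, IsFiniteKernel (κ j) := fun j =>
    isFiniteKernel_truncRestrict _ _ ENNReal.ofReal_lt_top
  have hκball : ∀ j μ, ∀ᵐ y ∂(κ j μ), ‖y - centerA L‖ ≤ L / √2 := fun j μ => by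
    have : ∀ᵐ y ∂(κ j μ), y ∈ ballA L := truncRestrict_compl (hV j) hA μ
    filter_upwards [this] with y hy using norm_sub_centerA_le hy
  have hbound : ∀ y : E2, ‖y - centerA L‖ ≤ L / √2 → ‖y‖ ≤ L / √2 + L / √2 := fun y hy => by
    have := norm_add_le (y - centerA L) (centerA L)
    rw [sub_add_cancel] at this
    linarith [norm_centerA_le hL]
  have hκint : ∀ j μ, Integrable (fun y : E2 => y) (κ j μ) := fun j μ =>
    Integrable.of_bound (by fun_prop) (L / √2 + L / √2)
      ((hκball j μ).mono fun y hy => hbound y hy)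
  have hPκ : ∀ᵐ μ ∂P, ∀ j, κ j μ = μ.restrict (Vcell k c j.castSucc) := by
    filter_upwards [hP] with μ hμ j using truncRestrict_eq _ _ (hμ.2.2 j) hμ.2.1
  let Y : Measure E2 → PiLp 2 (fun _ : Fin k => E2) := fun μ =>
    WithLp.toLp 2 fun j => ∫ y, y ∂(κ j μ)
  have hYj : ∀ j, Measurable fun μ => ∫ y, y ∂(κ j μ) := fun j =>
    (StronglyMeasurable.integral_kernel (κ := κ j) stronglyMeasurable_id).measurable
  have hY : Measurable Y :=
    (WithLp.measurable_toLp 2 _).comp (measurable_pi_iff.2 hYj)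
  have hYball : ∀ j μ, ‖∫ y, y ∂(κ j μ) - (2 * m0) • centerA L‖ ≤ 2 * m0 * (L / √2) :=
    fun j μ => norm_integral_sub_smul_le (by positivity) (truncRestrict_univ_le _ _ μ)
      (norm_centerA_le hL) (hκball j μ)
  set R := √k * (2 * m0 * (L / √2)) with hR
  have hk' : (0 : ℝ) < k := by exact_mod_cast hk
  have hn' : (0 : ℝ) < n := by exact_mod_cast hn
  have hYb : ∀ μ, ‖Y μ - WithLp.toLp 2 fun _ => (2 * m0) • centerA L‖ ≤ R := fun μ => by
    rw [PiLp.norm_eq_of_L2]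
    refine Real.sqrt_le_iff.2 ⟨by positivity, ?_⟩
    rw [hR, mul_pow, Real.sq_sqrt hk'.le]
    calc _ ≤ ∑ _j : Fin k, (2 * m0 * (L / √2)) ^ 2 := by
          refine Finset.sum_le_sum fun j _ => ?_
          gcongr
          exact hYball j μ
      _ = _ := by simp
  have hYji : ∀ j, Integrable (fun μ => ∫ y, y ∂(κ j μ)) P := fun j =>
    Integrable.of_bound (hYj j).aestronglyMeasurable
      (2 * m0 * (L / √2) + ‖(2 * m0) • centerA L‖) (Filter.Eventually.of_forall fun μ => by
        have := norm_add_le (∫ y, y ∂(κ j μ) - (2 * m0) • centerA L) ((2 * m0) • centerA L)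
        rw [sub_add_cancel] at this
        linarith [hYball j μ])
  have hjoin : ∀ j, w2 k c P.join j = (∫ μ, Y μ ∂P) j := fun j => by
    rw [eval_integral_piLp hYji j, w2,
      join_restrict_eq_comp_truncRestrict (hV j) hA (M := M)
        (hP.mono fun μ hμ => ⟨hμ.2.2 j, hμ.2.1⟩)]
    change ∫ y, y ∂(P.bind (κ j)) = ∫ μ, ∫ y, y ∂(κ j μ) ∂P
    have hfin : IsFiniteMeasure (P.bind (κ j)) := inferInstance
    have hae : ∀ᵐ y ∂(P.bind (κ j)), ‖y‖ ≤ L / √2 + L / √2 :=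
      Measure.ae_comp_of_ae_ae (measurableSet_le (by fun_prop) (by fun_prop))
        (Filter.Eventually.of_forall fun μ => (hκball j μ).mono fun y hy => hbound y hy)
    have hi : Integrable (fun y : E2 => y) (P.bind (κ j)) :=
      Integrable.of_bound (by fun_prop) _ hae
    rw [Measure.comp_eq_comp_const_apply] at hi ⊢
    rw [Kernel.integral_comp hi, Kernel.const_apply]
  have hemp : ∀ᵐ ω ∂(Measure.pi fun _ : Fin n => P), ∀ i j,
      κ j (ω i) = (ω i).restrict (Vcell k c j.castSucc) :=
    ae_all_iff.2 fun i =>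
      (measurePreserving_eval (fun _ : Fin n => P) i).quasiMeasurePreserving.ae hPκ
  have hconst : 2 * R / √n = 2 * m0 * L * √(2 * k / n) := by
    rw [hR, Real.sqrt_div (by positivity), Real.sqrt_mul (by norm_num)]
    have : √2 ^ 2 = (2 : ℝ) := Real.sq_sqrt (by norm_num)
    field_simp
    linarith
  have key := measure_norm_mean_sub_ge_le P hY (WithLp.toLp 2 fun _ => (2 * m0) • centerA L)
    (by positivity) hYb hn hx
  rw [hconst] at key
  set Q := Measure.pi fun _ : Fin n => P with hQ
  set T : Set (Fin n → Measure E2) := {ω | 2 * m0 * L * √(2 * k / n) * (1 + √(x / 2)) <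
    ‖(n : ℝ)⁻¹ • ∑ i, Y (ω i) - ∫ μ, Y μ ∂P‖} with hT
  have hTm : MeasurableSet T := measurableSet_lt measurable_const (by fun_prop)
  calc ENNReal.ofReal (1 - Real.exp (-x)) ≤ ENNReal.ofReal (Q.real Tᶜ) := by
        refine ENNReal.ofReal_le_ofReal ?_
        rw [probReal_compl_eq_one_sub hTm]
        linarith
    _ = Q Tᶜ := ofReal_measureReal
    _ ≤ _ := by
        refine measure_mono_ae ?_
        filter_upwards [hemp] with ω hω hωT
        have hωT' : ‖(n : ℝ)⁻¹ • ∑ i, Y (ω i) - ∫ μ, Y μ ∂P‖ ≤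
            2 * m0 * L * √(2 * k / n) * (1 + √(x / 2)) := not_lt.1 hωT
        refine le_trans (le_of_eq ?_) hωT'
        rw [PiLp.norm_eq_of_L2, pnorm2]
        congr 1
        refine Finset.sum_congr rfl fun j _ => ?_
        rw [w2_empEPD c ω j fun i => by rw [IntegrableOn, ← hω i j]; exact hκint j _, hjoin]
        simp [Y, w2, hω]

end
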